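/- For every n ≥ 3, the quantities for consecutive generations of the pseudofractal scale-free web satisfy c_{n+1}^0 = min{3c_n^0, 2c_n^0 + d_n^0, 2c_n^0 + b_n^2, 2c_n^0 + c_n^1}. -/

import Mathlib

/-!
Common definitions: the pseudofractal scale-free web `pfw n` (= `G_n` for `n ≥ 1`)
and the Sierpinski graph `sierp n` (= `S_n` for `n ≥ 1`), together with the
edge-domination notions used in the paper.
-/

open scoped Classical

noncomputable section

/-- A finite graph generation: a finite vertex type, a finite set of edges
(unordered pairs of vertices), and three designated hub/outmost vertices. -/
structure GraphGen : Type 1 where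
  V : Type
  fin : Fintype V
  edges : Finset (Sym2 V)
  hubs : Fin 3 → V

attribute [instance] GraphGen.fin

/-- The triangle (complete graph on three vertices), the common first generation. -/
def triangle : GraphGen where
  V := Fin 3
  fin := inferInstance
  edges := {s((0 : Fin 3), (1 : Fin 3)), s((0 : Fin 3), (2 : Fin 3)), s((1 : Fin 3), (2 : Fin 3))}
  hubs := fun i => i

/-- One iteration step of the pseudofractal scale-free web: for every existing
edge `{u,v}` a new vertex is added and joined to both `u` and `v`. -/
def pfwStep (X : GraphGen) : GraphGen where
  V := X.V ⊕ {e : Sym2 X.V // e ∈ X.edges}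
  fin := inferInstance
  edges :=
    X.edges.image (Sym2.map Sum.inl) ∪
      X.edges.attach.biUnion fun e =>
        (Finset.univ.filter fun v : X.V => v ∈ (e : Sym2 X.V)).image fun v =>
          s((Sum.inl v : X.V ⊕ {e : Sym2 X.V // e ∈ X.edges}), Sum.inr e)
  hubs := fun i => Sum.inl (X.hubs i)

private def pfwAux : ℕ → GraphGen
  | 0 => triangle
  | n + 1 => pfwStep (pfwAux n)

/-- `pfw n` is the pseudofractal scale-free web `G_n` (for `n ≥ 1`):
`G_1` is a triangle and `G_{n+1}` is obtained from `G_n` by adding, for each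
edge, a new vertex adjacent to both of its endpoints.  Its hubs are the three
vertices of `G_1`. -/
def pfw (n : ℕ) : GraphGen := pfwAux (n - 1)

/-- The identification relation used to glue three copies of the Sierpinski
graph: `B^(1) ~ A^(2)`, `C^(1) ~ A^(3)`, `C^(2) ~ B^(3)` (copies indexed by
`0, 1, 2` and outmost vertices `A = hubs 0`, `B = hubs 1`, `C = hubs 2`). -/
def sierpRel (X : GraphGen) : Fin 3 × X.V → Fin 3 × X.V → Prop := fun p q =>
  (p = ((0 : Fin 3), X.hubs 1) ∧ q = ((1 : Fin 3), X.hubs 0)) ∨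
  (p = ((0 : Fin 3), X.hubs 2) ∧ q = ((2 : Fin 3), X.hubs 0)) ∨
  (p = ((1 : Fin 3), X.hubs 2) ∧ q = ((2 : Fin 3), X.hubs 1))

/-- One iteration step of the Sierpinski graph: three disjoint copies of the
previous generation are glued along their outmost vertices. -/
def sierpStep (X : GraphGen) : GraphGen where
  V := Quotient (Relation.EqvGen.setoid (sierpRel X))
  fin := inferInstance
  edges :=
    (Finset.univ : Finset (Fin 3)).biUnion fun t =>
      X.edges.image (Sym2.map fun v => Quotient.mk (Relation.EqvGen.setoid (sierpRel X)) (t, v))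
  hubs := fun i => Quotient.mk (Relation.EqvGen.setoid (sierpRel X)) (i, X.hubs i)

private def sierpAux : ℕ → GraphGen
  | 0 => triangle
  | n + 1 => sierpStep (sierpAux n)

/-- `sierp n` is the Sierpinski graph `S_n` (for `n ≥ 1`):
`S_1` is a triangle, and `S_{n+1}` is obtained by gluing three copies of `S_n`
at their outmost vertices.  Its `hubs` are the three outmost vertices. -/
def sierp (n : ℕ) : GraphGen := sierpAux (n - 1)

/-- An edge `e` is dominated by the edge set `F` if it belongs to `F` or
shares an endpoint with some edge of `F`. -/
def Dominated (X : GraphGen) (F : Finset (Sym2 X.V)) (e : Sym2 X.V) : Prop :=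
  e ∈ F ∨ ∃ f ∈ F, ∃ v, v ∈ e ∧ v ∈ f

/-- `F` is an edge dominating set: a set of edges of `X` such that every edge
not in `F` shares an endpoint with some edge of `F`. -/
def IsEDS (X : GraphGen) (F : Finset (Sym2 X.V)) : Prop :=
  F ⊆ X.edges ∧ ∀ e ∈ X.edges, e ∉ F → ∃ f ∈ F, ∃ v, v ∈ e ∧ v ∈ f

/-- The edge domination number: the minimum cardinality of an edge dominating set. -/
def edsNum (X : GraphGen) : ℕ := sInf {k | ∃ F, IsEDS X F ∧ F.card = k}

/-- A minimum edge dominating set: an EDS whose cardinality equals the edge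
domination number. -/
def IsMEDS (X : GraphGen) (F : Finset (Sym2 X.V)) : Prop :=
  IsEDS X F ∧ F.card = edsNum X

/-- Hub number `i` is filled w.r.t. `F`: some edge incident to it lies in `F`. -/
def FilledHub (X : GraphGen) (F : Finset (Sym2 X.V)) (i : Fin 3) : Prop :=
  ∃ f ∈ F, X.hubs i ∈ f

/-- Hub number `i` is cross w.r.t. `F`: no edge incident to it lies in `F` and
some edge incident to it is not dominated by `F`. -/
def CrossHub (X : GraphGen) (F : Finset (Sym2 X.V)) (i : Fin 3) : Prop :=
  ¬ FilledHub X F i ∧ ∃ e ∈ X.edges, X.hubs i ∈ e ∧ ¬ Dominated X F e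

/-- Hub number `i` is empty w.r.t. `F`: it is neither filled nor cross. -/
def EmptyHub (X : GraphGen) (F : Finset (Sym2 X.V)) (i : Fin 3) : Prop :=
  ¬ FilledHub X F i ∧ ¬ CrossHub X F i

/-- `F` is admissible: a set of edges of `X` such that every edge not dominated
by `F` is incident to a cross hub vertex. -/
def Admissible (X : GraphGen) (F : Finset (Sym2 X.V)) : Prop :=
  F ⊆ X.edges ∧
    ∀ e ∈ X.edges, ¬ Dominated X F e → ∃ i, CrossHub X F i ∧ X.hubs i ∈ e

/-- The number of filled hub vertices w.r.t. `F`. -/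
def numFilled (X : GraphGen) (F : Finset (Sym2 X.V)) : ℕ :=
  (Finset.univ.filter fun i : Fin 3 => FilledHub X F i).card

/-- The number of cross hub vertices w.r.t. `F`. -/
def numCross (X : GraphGen) (F : Finset (Sym2 X.V)) : ℕ :=
  (Finset.univ.filter fun i : Fin 3 => CrossHub X F i).card

/-- `minAdm X nf i` is the minimum cardinality of an admissible set with exactly
`nf` filled hub vertices and exactly `i` cross hub vertices. -/
def minAdm (X : GraphGen) (nf i : ℕ) : ℕ :=
  sInf {k | ∃ F, Admissible X F ∧ numFilled X F = nf ∧ numCross X F = i ∧ F.card = k}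

/-- The class of admissible sets with exactly `nf` filled and exactly `i` cross
hub vertices attaining the minimum cardinality among such sets. -/
def admClass (X : GraphGen) (nf i : ℕ) : Set (Finset (Sym2 X.V)) :=
  {F | Admissible X F ∧ numFilled X F = nf ∧ numCross X F = i ∧ F.card = minAdm X nf i}

/-- `a_n^i`: minimum cardinality of an admissible set with no filled hub and `i` cross hubs. -/
def aq (X : GraphGen) (i : ℕ) : ℕ := minAdm X 0 i

/-- `b_n^i`: minimum cardinality of an admissible set with one filled hub and `i` cross hubs. -/
def bq (X : GraphGen) (i : ℕ) : ℕ := minAdm X 1 i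

/-- `c_n^i`: minimum cardinality of an admissible set with two filled hubs and `i` cross hubs. -/
def cq (X : GraphGen) (i : ℕ) : ℕ := minAdm X 2 i

/-- `d_n^i`: minimum cardinality of an admissible set with three filled hubs and `i` cross hubs. -/
def dq (X : GraphGen) (i : ℕ) : ℕ := minAdm X 3 i

end


/-- The vertex `v` is an endpoint of some edge of `F`. -/
def Touched {V : Type} (F : Finset (Sym2 V)) (v : V) : Prop := ∃ f ∈ F, v ∈ f

/-- The edge `e` has an endpoint touched by `F`. -/
def Covered {V : Type} (F : Finset (Sym2 V)) (e : Sym2 V) : Prop := ∃ v ∈ e, Touched F v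

lemma covered_of_mem {V : Type} {F : Finset (Sym2 V)} {e : Sym2 V} (he : e ∈ F) : Covered F e := by
  induction e with
  | _ a b => exact ⟨a, Sym2.mem_mk_left a b, _, he, Sym2.mem_mk_left a b⟩

lemma dominated_iff_covered {X : GraphGen} {F : Finset (Sym2 X.V)} {e : Sym2 X.V} :
    Dominated X F e ↔ Covered F e := by
  constructor
  · rintro (h | ⟨f, hf, v, hve, hvf⟩)
    · exact covered_of_mem h
    · exact ⟨v, hve, f, hf, hvf⟩
  · rintro ⟨v, hve, f, hf, hvf⟩
    exact Or.inr ⟨f, hf, v, hve, hvf⟩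

/-- A loopless graph whose three hubs are pairwise adjacent. -/
structure HubTriangle (X : GraphGen) : Prop where
  loopless : ∀ e ∈ X.edges, ¬ e.IsDiag
  adj : ∀ i j, i ≠ j → s(X.hubs i, X.hubs j) ∈ X.edges

lemma HubTriangle.hubs_injective {X : GraphGen} (hX : HubTriangle X) :
    Function.Injective X.hubs := by
  intro i j hij
  by_contra hne
  exact hX.loopless _ (hX.adj i j hne) (Sym2.mk_isDiag_iff.mpr hij)

/-- An old vertex, seen in the next generation. -/
def oldV {X : GraphGen} (v : X.V) : (pfwStep X).V := Sum.inl v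

/-- The new vertex attached to an edge. -/
def newV {X : GraphGen} (a : {a : Sym2 X.V // a ∈ X.edges}) : (pfwStep X).V := Sum.inr a

lemma oldV_injective {X : GraphGen} : Function.Injective (oldV (X := X)) := Sum.inl_injective

lemma newV_injective {X : GraphGen} : Function.Injective (newV (X := X)) := Sum.inr_injective

lemma oldV_ne_newV {X : GraphGen} (v : X.V) (a : {a : Sym2 X.V // a ∈ X.edges}) :
    oldV v ≠ newV a := Sum.inl_ne_inr

lemma mem_pfwStep_edges {X : GraphGen} {e : Sym2 (pfwStep X).V} :
    e ∈ (pfwStep X).edges ↔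
      (∃ a ∈ X.edges, Sym2.map oldV a = e) ∨
      ∃ (a : {a : Sym2 X.V // a ∈ X.edges}) (v : X.V), v ∈ a.1 ∧ s(oldV v, newV a) = e := by
  have key (e : Sym2 (X.V ⊕ {a : Sym2 X.V // a ∈ X.edges})) :
      e ∈ X.edges.image (Sym2.map Sum.inl) ∪
        (X.edges.attach.biUnion fun e =>
          (Finset.univ.filter fun v : X.V => v ∈ (e : Sym2 X.V)).image fun v =>
            s((Sum.inl v : X.V ⊕ {e : Sym2 X.V // e ∈ X.edges}), Sum.inr e)) ↔
      (∃ a ∈ X.edges, Sym2.map Sum.inl a = e) ∨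
      ∃ (a : {a : Sym2 X.V // a ∈ X.edges}) (v : X.V), v ∈ a.1 ∧
        s(Sum.inl v, Sum.inr a) = e := by
    simp only [Finset.mem_union, Finset.mem_image, Finset.mem_biUnion, Finset.mem_attach,
      Finset.mem_filter, Finset.mem_univ, true_and]
  exact key e

lemma mem_triangle_edges (i j : Fin 3) : s(i, j) ∈ triangle.edges ↔ i ≠ j := by
  refine (Finset.mem_insert.trans (or_congr Iff.rfl
    (Finset.mem_insert.trans (or_congr Iff.rfl Finset.mem_singleton)))).trans ?_
  revert i j
  decide

lemma hubTriangle_triangle : HubTriangle triangle := by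
  refine ⟨fun e he => ?_, fun i j hij => (mem_triangle_edges i j).mpr hij⟩
  induction e with
  | _ i j => exact (mem_triangle_edges i j).mp he

lemma HubTriangle.pfwStep {X : GraphGen} (hX : HubTriangle X) : HubTriangle (pfwStep X) := by
  constructor
  · intro e he
    rcases mem_pfwStep_edges.mp he with ⟨a, ha, rfl⟩ | ⟨a, v, -, rfl⟩
    · rw [Sym2.isDiag_map oldV_injective]
      exact hX.loopless a ha
    · exact oldV_ne_newV v a
  · intro i j hij
    exact mem_pfwStep_edges.mpr (Or.inl ⟨_, hX.adj i j hij, rfl⟩)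

/-- `Y` is obtained by gluing three copies of `X` along hubs: in the copy `k`, hub `i ≠ k` is the
hub `i` of `Y`, and different copies only meet in such hubs. -/
structure IsGluing (X Y : GraphGen) (φ : Fin 3 → X.V → Y.V) : Prop where
  inj : ∀ k, Function.Injective (φ k)
  mem_edges : ∀ e, e ∈ Y.edges ↔ ∃ k, ∃ a ∈ X.edges, Sym2.map (φ k) a = e
  hub : ∀ k i, i ≠ k → φ k (X.hubs i) = Y.hubs i
  meet : ∀ k l u v, k ≠ l → φ k u = φ l v → ∃ i, i ≠ k ∧ i ≠ l ∧ u = X.hubs i ∧ v = X.hubs i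

lemma eq_of_two_ne {k l i j : Fin 3} (hkl : k ≠ l) (hik : i ≠ k) (hil : i ≠ l) (hjk : j ≠ k)
    (hjl : j ≠ l) : i = j := by
  omega

lemma IsGluing.map_ne {X Y : GraphGen} {φ : Fin 3 → X.V → Y.V} (h : IsGluing X Y φ)
    (hX : HubTriangle X) {k l : Fin 3} (hkl : k ≠ l) {a b : Sym2 X.V} (ha : a ∈ X.edges) :
    Sym2.map (φ k) a ≠ Sym2.map (φ l) b := by
  intro hab
  have key : ∀ u ∈ a, ∃ i, i ≠ k ∧ i ≠ l ∧ u = X.hubs i := by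
    intro u hu
    have : φ k u ∈ Sym2.map (φ l) b := hab ▸ Sym2.mem_map.mpr ⟨u, hu, rfl⟩
    obtain ⟨v, -, hv⟩ := Sym2.mem_map.mp this
    obtain ⟨i, h1, h2, h3, -⟩ := h.meet k l u v hkl hv.symm
    exact ⟨i, h1, h2, h3⟩
  induction a with
  | _ p q =>
    obtain ⟨i, hik, hil, rfl⟩ := key p (Sym2.mem_mk_left _ _)
    obtain ⟨j, hjk, hjl, rfl⟩ := key q (Sym2.mem_mk_right _ _)
    apply hX.loopless _ ha
    rw [Sym2.mk_isDiag_iff, eq_of_two_ne hkl hik hil hjk hjl]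

lemma IsGluing.eq_hub {X Y : GraphGen} {φ : Fin 3 → X.V → Y.V} (h : IsGluing X Y φ)
    (hX : HubTriangle X) {k i : Fin 3} {u : X.V} (hu : φ k u = Y.hubs i) :
    i ≠ k ∧ u = X.hubs i := by
  by_cases hik : i = k
  · subst hik
    obtain ⟨l, hl⟩ : ∃ l : Fin 3, l ≠ i := exists_ne i
    rw [← h.hub l i hl.symm] at hu
    obtain ⟨j, hji, -, -, hj⟩ := h.meet i l _ _ hl.symm hu
    exact absurd (hX.hubs_injective hj).symm hji
  · exact ⟨hik, h.inj k (hu.trans (h.hub k i hik).symm)⟩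

lemma IsGluing.map_mem {X Y : GraphGen} {φ : Fin 3 → X.V → Y.V} (h : IsGluing X Y φ)
    (k : Fin 3) {a : Sym2 X.V} (ha : a ∈ X.edges) : Sym2.map (φ k) a ∈ Y.edges :=
  (h.mem_edges _).mpr ⟨k, a, ha, rfl⟩

/-- The extension of a copy map to one more iteration step. -/
def stepMap {X Y : GraphGen} (f : X.V → Y.V)
    (hf : ∀ a ∈ X.edges, Sym2.map f a ∈ Y.edges) : (pfwStep X).V → (pfwStep Y).V :=
  Sum.map f fun a => ⟨Sym2.map f a.1, hf a.1 a.2⟩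

lemma IsGluing.pfwStep {X Y : GraphGen} {φ : Fin 3 → X.V → Y.V} (h : IsGluing X Y φ)
    (hX : HubTriangle X) :
    IsGluing (pfwStep X) (pfwStep Y) fun k => stepMap (φ k) fun _ ha => h.map_mem k ha := by
  refine ⟨fun k => ?_, fun e => ?_, fun k i hik => ?_, fun k l u v hkl huv => ?_⟩
  · refine Sum.map_injective.mpr ⟨h.inj k, fun a b hab => ?_⟩
    exact Subtype.ext (Sym2.map.injective (h.inj k) (congrArg Subtype.val hab))
  · rw [mem_pfwStep_edges]
    constructor
    · rintro (⟨a, ha, rfl⟩ | ⟨⟨a, ha⟩, v, hv, rfl⟩)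
      · obtain ⟨k, b, hb, rfl⟩ := (h.mem_edges a).mp ha
        refine ⟨k, Sym2.map oldV b, mem_pfwStep_edges.mpr (Or.inl ⟨b, hb, rfl⟩), ?_⟩
        rw [Sym2.map_map, Sym2.map_map]
        rfl
      · obtain ⟨k, b, hb, rfl⟩ := (h.mem_edges a).mp ha
        obtain ⟨w, hw, rfl⟩ := Sym2.mem_map.mp hv
        exact ⟨k, s(oldV w, newV ⟨b, hb⟩),
          mem_pfwStep_edges.mpr (Or.inr ⟨⟨b, hb⟩, w, hw, rfl⟩), rfl⟩
    · rintro ⟨k, a, ha, rfl⟩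
      rcases mem_pfwStep_edges.mp ha with ⟨b, hb, rfl⟩ | ⟨⟨b, hb⟩, v, hv, rfl⟩
      · refine Or.inl ⟨Sym2.map (φ k) b, h.map_mem k hb, ?_⟩
        rw [Sym2.map_map, Sym2.map_map]
        rfl
      · exact Or.inr ⟨⟨Sym2.map (φ k) b, h.map_mem k hb⟩, φ k v, Sym2.mem_map.mpr ⟨v, hv, rfl⟩, rfl⟩
  · exact congrArg Sum.inl (h.hub k i hik)
  · rcases u with u | u <;> rcases v with v | v
    · obtain ⟨i, h1, h2, h3, h4⟩ := h.meet k l u v hkl (Sum.inl_injective huv)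
      exact ⟨i, h1, h2, congrArg Sum.inl h3, congrArg Sum.inl h4⟩
    · exact absurd huv Sum.inl_ne_inr
    · exact absurd huv Sum.inr_ne_inl
    · exact absurd (congrArg Subtype.val (Sum.inr_injective huv)) (h.map_ne hX hkl u.2)

lemma triangle_edge_mem (k : Fin 3) : s(k + 1, k + 2) ∈ triangle.edges :=
  hubTriangle_triangle.adj (k + 1) (k + 2) (by fin_cases k <;> decide)

/-- The copies of the triangle in the second generation. -/
noncomputable def triangleCopy (k i : Fin 3) : (pfwStep triangle).V :=
  if i = k then newV ⟨_, triangle_edge_mem k⟩ else oldV (X := triangle) i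

lemma triangleCopy_self (k : Fin 3) : triangleCopy k k = newV ⟨_, triangle_edge_mem k⟩ :=
  if_pos rfl

lemma triangleCopy_of_ne {k i : Fin 3} (h : i ≠ k) :
    triangleCopy k i = oldV (X := triangle) i :=
  if_neg h

lemma triangleCopy_cases (k i : Fin 3) :
    (i = k ∧ triangleCopy k i = newV ⟨_, triangle_edge_mem k⟩) ∨
      (i ≠ k ∧ triangleCopy k i = oldV (X := triangle) i) := by
  by_cases h : i = k
  · exact Or.inl ⟨h, h ▸ triangleCopy_self i⟩
  · exact Or.inr ⟨h, triangleCopy_of_ne h⟩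

lemma isGluing_triangle : IsGluing triangle (pfwStep triangle) triangleCopy := by
  refine ⟨fun k (u : Fin 3) (v : Fin 3) huv => ?_, fun e => ⟨fun he => ?_, ?_⟩,
    fun k i hik => triangleCopy_of_ne hik, fun k l (u : Fin 3) (v : Fin 3) hkl huv => ?_⟩
  · rcases triangleCopy_cases k u with ⟨hu, hu'⟩ | ⟨hu, hu'⟩ <;>
      rcases triangleCopy_cases k v with ⟨hv, hv'⟩ | ⟨hv, hv'⟩ <;> rw [hu', hv'] at huv
    · exact hu.trans hv.symm
    · exact absurd huv.symm (oldV_ne_newV _ _)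
    · exact absurd huv (oldV_ne_newV _ _)
    · exact oldV_injective huv
  · rcases mem_pfwStep_edges.mp he with ⟨a, ha, rfl⟩ | ⟨⟨a, ha⟩, v, hv, rfl⟩
    · induction a with
      | _ i j =>
        obtain ⟨k, hik, hjk⟩ : ∃ k : Fin 3, (i : Fin 3) ≠ k ∧ (j : Fin 3) ≠ k :=
          (by decide : ∀ i j : Fin 3, ∃ k, i ≠ k ∧ j ≠ k) i j
        refine ⟨k, _, ha, ?_⟩
        change s(triangleCopy k i, triangleCopy k j) = s(oldV i, oldV j)
        rw [triangleCopy_of_ne hik, triangleCopy_of_ne hjk]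
    · obtain ⟨k, rfl⟩ : ∃ k : Fin 3, a = s(k + 1, k + 2) := by
        induction a with
        | _ i j =>
          exact (by decide : ∀ i j : Fin 3, i ≠ j → ∃ k : Fin 3, s(i, j) = s(k + 1, k + 2)) i j
            ((mem_triangle_edges i j).mp ha)
      have hvk : (v : Fin 3) ≠ k :=
        (by decide : ∀ k v : Fin 3, v ∈ s(k + 1, k + 2) → v ≠ k) k v hv
      refine ⟨k, s(v, k), (mem_triangle_edges v k).mpr hvk, ?_⟩
      change s(triangleCopy k v, triangleCopy k k) = _
      rw [triangleCopy_of_ne hvk, triangleCopy_self]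
  · rintro ⟨k, a, ha, rfl⟩
    have new_mem : ∀ v : Fin 3, v ≠ k →
        s(oldV (X := triangle) v, newV ⟨_, triangle_edge_mem k⟩) ∈ (pfwStep triangle).edges :=
      fun v hv => mem_pfwStep_edges.mpr (Or.inr ⟨⟨_, triangle_edge_mem k⟩, v,
        (by decide : ∀ k v : Fin 3, v ≠ k → v ∈ s(k + 1, k + 2)) k v hv, rfl⟩)
    induction a with
    | _ i j =>
      have hij : (i : Fin 3) ≠ j := (mem_triangle_edges i j).mp ha
      change s(triangleCopy k i, triangleCopy k j) ∈ _
      rcases triangleCopy_cases k i with ⟨hi, hi'⟩ | ⟨hi, hi'⟩ <;>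
        rcases triangleCopy_cases k j with ⟨hj, hj'⟩ | ⟨hj, hj'⟩ <;> rw [hi', hj']
      · exact absurd (hi.trans hj.symm) hij
      · rw [Sym2.eq_swap]
        exact new_mem j hj
      · exact new_mem i hi
      · exact mem_pfwStep_edges.mpr (Or.inl ⟨_, ha, rfl⟩)
  · rcases triangleCopy_cases k u with ⟨hu, hu'⟩ | ⟨hu, hu'⟩ <;>
      rcases triangleCopy_cases l v with ⟨hv, hv'⟩ | ⟨hv, hv'⟩ <;> rw [hu', hv'] at huv
    · exact absurd (congrArg Subtype.val (newV_injective huv))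
        ((by decide : ∀ k l : Fin 3, k ≠ l → s(k + 1, k + 2) ≠ s(l + 1, l + 2)) k l hkl)
    · exact absurd huv.symm (oldV_ne_newV _ _)
    · exact absurd huv (oldV_ne_newV _ _)
    · obtain rfl : u = v := oldV_injective huv
      exact ⟨u, hu, hv, rfl, rfl⟩

/-- The part of `F` lying in the image of `f`, pulled back to `X`. -/
noncomputable def pullback {X Y : GraphGen} (f : X.V → Y.V) (F : Finset (Sym2 Y.V)) : Finset (Sym2 X.V) :=
  X.edges.filter fun a => Sym2.map f a ∈ F

lemma touched_of_pullback {X Y : GraphGen} {f : X.V → Y.V} {F : Finset (Sym2 Y.V)} {u : X.V}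
    (hu : Touched (pullback f F) u) : Touched F (f u) := by
  obtain ⟨a, ha, hua⟩ := hu
  exact ⟨_, (Finset.mem_filter.mp ha).2, Sym2.mem_map.mpr ⟨u, hua, rfl⟩⟩

lemma IsGluing.touched_pullback {X Y : GraphGen} {φ : Fin 3 → X.V → Y.V} (h : IsGluing X Y φ)
    {F : Finset (Sym2 Y.V)} (hF : F ⊆ Y.edges) {k : Fin 3} {u : X.V} (hu : Touched F (φ k u)) :
    Touched (pullback (φ k) F) u ∨ ∃ i, i ≠ k ∧ u = X.hubs i := by
  obtain ⟨f, hf, huf⟩ := hu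
  obtain ⟨l, a, ha, rfl⟩ := (h.mem_edges f).mp (hF hf)
  obtain ⟨v, hv, hvu⟩ := Sym2.mem_map.mp huf
  by_cases hkl : k = l
  · subst hkl
    obtain rfl := h.inj k hvu
    exact Or.inl ⟨a, Finset.mem_filter.mpr ⟨ha, hf⟩, hv⟩
  · obtain ⟨i, hik, -, hi, -⟩ := h.meet k l u v hkl hvu.symm
    exact Or.inr ⟨i, hik, hi⟩

lemma IsGluing.sum_card_pullback_le {X Y : GraphGen} {φ : Fin 3 → X.V → Y.V}
    (h : IsGluing X Y φ) (hX : HubTriangle X) (F : Finset (Sym2 Y.V)) :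
    ∑ k, (pullback (φ k) F).card ≤ F.card := by
  calc ∑ k, (pullback (φ k) F).card
      = ∑ k, ((pullback (φ k) F).image (Sym2.map (φ k))).card :=
        Finset.sum_congr rfl fun k _ =>
          (Finset.card_image_of_injective _ (Sym2.map.injective (h.inj k))).symm
    _ = (Finset.univ.biUnion fun k => (pullback (φ k) F).image (Sym2.map (φ k))).card := by
        refine (Finset.card_biUnion fun k _ l _ hkl => ?_).symm
        refine Finset.disjoint_left.mpr ?_
        intro e hk hl
        obtain ⟨a, ha, rfl⟩ := Finset.mem_image.mp hk
        obtain ⟨b, -, hb⟩ := Finset.mem_image.mp hl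
        exact h.map_ne hX hkl (Finset.mem_filter.mp ha).1 hb.symm
    _ ≤ F.card := by
        refine Finset.card_le_card (Finset.biUnion_subset.mpr fun k _ => ?_)
        intro e he
        obtain ⟨a, ha, rfl⟩ := Finset.mem_image.mp he
        exact (Finset.mem_filter.mp ha).2

/-- Every edge of `X` not covered by `F` is incident to a hub other than hub `h`. -/
def CoversOff (X : GraphGen) (h : Fin 3) (F : Finset (Sym2 X.V)) : Prop :=
  ∀ e ∈ X.edges, ¬ Covered F e → ∃ i, i ≠ h ∧ X.hubs i ∈ e

/-- Every edge of `X` not covered by `F` is incident to a hub. -/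
def CoversOffHubs (X : GraphGen) (F : Finset (Sym2 X.V)) : Prop :=
  ∀ e ∈ X.edges, ¬ Covered F e → ∃ i, X.hubs i ∈ e

lemma CoversOff.coversOffHubs {X : GraphGen} {h : Fin 3} {F : Finset (Sym2 X.V)}
    (hF : CoversOff X h F) : CoversOffHubs X F := fun e he hc =>
  let ⟨i, _, hi⟩ := hF e he hc
  ⟨i, hi⟩

lemma IsGluing.coversOff_pullback {X Y : GraphGen} {φ : Fin 3 → X.V → Y.V} (h : IsGluing X Y φ)
    (hX : HubTriangle X) {F : Finset (Sym2 Y.V)} (hF : F ⊆ Y.edges) (hc : CoversOffHubs Y F)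
    (k : Fin 3) : CoversOff X k (pullback (φ k) F) := by
  intro e he hn
  by_cases hcov : Covered F (Sym2.map (φ k) e)
  · obtain ⟨v, hv, ht⟩ := hcov
    obtain ⟨u, hu, rfl⟩ := Sym2.mem_map.mp hv
    rcases h.touched_pullback hF ht with ht' | ⟨i, hik, rfl⟩
    · exact absurd ⟨u, hu, ht'⟩ hn
    · exact ⟨i, hik, hu⟩
  · obtain ⟨i, hi⟩ := hc _ (h.map_mem k he) hcov
    obtain ⟨u, hu, hui⟩ := Sym2.mem_map.mp hi
    obtain ⟨hik, rfl⟩ := h.eq_hub hX hui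
    exact ⟨i, hik, hu⟩

lemma IsGluing.coversOff_pullback_of_untouched {X Y : GraphGen} {φ : Fin 3 → X.V → Y.V}
    (h : IsGluing X Y φ) (hX : HubTriangle X) {F : Finset (Sym2 Y.V)} (hF : F ⊆ Y.edges)
    {j : Fin 3} (hc : CoversOff Y j F) (hj : ¬ Touched F (Y.hubs j)) {k : Fin 3} (hjk : j ≠ k) :
    CoversOff X j (pullback (φ k) F) ∧ ¬ Touched (pullback (φ k) F) (X.hubs j) := by
  refine ⟨fun e he hn => ?_, fun ht => hj (h.hub k j hjk ▸ touched_of_pullback ht)⟩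
  by_cases hcov : Covered F (Sym2.map (φ k) e)
  · obtain ⟨v, hv, ht⟩ := hcov
    obtain ⟨u, hu, rfl⟩ := Sym2.mem_map.mp hv
    rcases h.touched_pullback hF ht with ht' | ⟨i, hik, rfl⟩
    · exact absurd ⟨u, hu, ht'⟩ hn
    · refine ⟨i, fun hij => hj ?_, hu⟩
      rwa [h.hub k i hik, hij] at ht
  · obtain ⟨i, hij, hi⟩ := hc _ (h.map_mem k he) hcov
    obtain ⟨u, hu, hui⟩ := Sym2.mem_map.mp hi
    obtain ⟨-, rfl⟩ := h.eq_hub hX hui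
    exact ⟨i, hij, hu⟩

lemma IsGluing.pullback_card_pos {X Y : GraphGen} {φ : Fin 3 → X.V → Y.V}
    (h : IsGluing X Y φ) (hX : HubTriangle X) {F : Finset (Sym2 Y.V)} (hF : F ⊆ Y.edges)
    {j : Fin 3} (hc : CoversOff Y j F) (hj : ¬ Touched F (Y.hubs j)) {k : Fin 3} (hjk : j ≠ k) :
    1 ≤ (pullback (φ k) F).card := by
  have hcov : Covered F (Sym2.map (φ k) s(X.hubs j, X.hubs k)) := by
    by_contra hn
    obtain ⟨i, hij, hi⟩ := hc _ (h.map_mem k (hX.adj j k hjk)) hn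
    obtain ⟨u, hu, hui⟩ := Sym2.mem_map.mp hi
    obtain ⟨hik, rfl⟩ := h.eq_hub hX hui
    rcases Sym2.mem_iff.mp hu with hu | hu
    · exact hij (hX.hubs_injective hu)
    · exact hik (hX.hubs_injective hu)
  obtain ⟨v, hv, ht⟩ := hcov
  obtain ⟨u, hu, rfl⟩ := Sym2.mem_map.mp hv
  rcases Sym2.mem_iff.mp hu with rfl | rfl
  · rw [h.hub k j hjk] at ht
    exact absurd ht hj
  · rcases h.touched_pullback hF ht with ⟨a, ha, -⟩ | ⟨i, hik, hi⟩
    · exact Finset.card_pos.mpr ⟨a, ha⟩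
    · exact absurd (hX.hubs_injective hi).symm hik

/-- The union of three edge sets placed in the three copies. -/
noncomputable def glue {X Y : GraphGen} (φ : Fin 3 → X.V → Y.V) (F : Fin 3 → Finset (Sym2 X.V)) :
    Finset (Sym2 Y.V) :=
  Finset.univ.biUnion fun k => (F k).image (Sym2.map (φ k))

lemma mem_glue {X Y : GraphGen} {φ : Fin 3 → X.V → Y.V} {F : Fin 3 → Finset (Sym2 X.V)}
    {e : Sym2 Y.V} : e ∈ glue φ F ↔ ∃ k, ∃ a ∈ F k, Sym2.map (φ k) a = e := by
  simp [glue]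

lemma card_glue_le {X Y : GraphGen} (φ : Fin 3 → X.V → Y.V) (F : Fin 3 → Finset (Sym2 X.V)) :
    (glue φ F).card ≤ ∑ k, (F k).card :=
  Finset.card_biUnion_le.trans (Finset.sum_le_sum fun _ _ => Finset.card_image_le)

lemma IsGluing.glue_subset {X Y : GraphGen} {φ : Fin 3 → X.V → Y.V} (h : IsGluing X Y φ)
    {F : Fin 3 → Finset (Sym2 X.V)} (hF : ∀ k, F k ⊆ X.edges) : glue φ F ⊆ Y.edges := by
  intro e he
  obtain ⟨k, a, ha, rfl⟩ := mem_glue.mp he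
  exact h.map_mem k (hF k ha)

lemma touched_glue {X Y : GraphGen} {φ : Fin 3 → X.V → Y.V} {F : Fin 3 → Finset (Sym2 X.V)}
    {k : Fin 3} {u : X.V} (hu : Touched (F k) u) : Touched (glue φ F) (φ k u) := by
  obtain ⟨a, ha, hua⟩ := hu
  exact ⟨_, mem_glue.mpr ⟨k, a, ha, rfl⟩, Sym2.mem_map.mpr ⟨u, hua, rfl⟩⟩

lemma covered_glue {X Y : GraphGen} {φ : Fin 3 → X.V → Y.V} {F : Fin 3 → Finset (Sym2 X.V)}
    {k : Fin 3} {e : Sym2 X.V} (he : Covered (F k) e) :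
    Covered (glue φ F) (Sym2.map (φ k) e) := by
  obtain ⟨u, hu, ht⟩ := he
  exact ⟨φ k u, Sym2.mem_map.mpr ⟨u, hu, rfl⟩, touched_glue ht⟩

lemma IsGluing.touched_glue_hub_iff {X Y : GraphGen} {φ : Fin 3 → X.V → Y.V}
    (h : IsGluing X Y φ) (hX : HubTriangle X) {F : Fin 3 → Finset (Sym2 X.V)} {i : Fin 3} :
    Touched (glue φ F) (Y.hubs i) ↔ ∃ k, i ≠ k ∧ Touched (F k) (X.hubs i) := by
  constructor
  · rintro ⟨f, hf, hif⟩
    obtain ⟨k, a, ha, rfl⟩ := mem_glue.mp hf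
    obtain ⟨u, hu, hui⟩ := Sym2.mem_map.mp hif
    obtain ⟨hik, rfl⟩ := h.eq_hub hX hui
    exact ⟨k, hik, a, ha, hu⟩
  · rintro ⟨k, hik, ht⟩
    exact h.hub k i hik ▸ touched_glue ht

/-- The edge set `F` covers all edges of `X` and touches exactly the hubs satisfying `p`. -/
structure FullCover (X : GraphGen) (p : Fin 3 → Prop) (F : Finset (Sym2 X.V)) : Prop where
  subset : F ⊆ X.edges
  covers : ∀ e ∈ X.edges, Covered F e
  touched_iff : ∀ i, Touched F (X.hubs i) ↔ p i

lemma IsGluing.fullCover_glue {X Y : GraphGen} {φ : Fin 3 → X.V → Y.V} (h : IsGluing X Y φ)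
    (hX : HubTriangle X) {p : Fin 3 → Prop} {F : Fin 3 → Finset (Sym2 X.V)}
    (hF : ∀ k, F k ⊆ X.edges)
    (hcov : ∀ k, ∀ e ∈ X.edges, ¬ Covered (F k) e → ∃ i, i ≠ k ∧ p i ∧ X.hubs i ∈ e)
    (hp : ∀ i, p i ↔ ∃ k, i ≠ k ∧ Touched (F k) (X.hubs i)) :
    FullCover Y p (glue φ F) := by
  refine ⟨h.glue_subset hF, fun e he => ?_, fun i => ?_⟩
  · obtain ⟨k, a, ha, rfl⟩ := (h.mem_edges e).mp he
    by_cases hc : Covered (F k) a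
    · exact covered_glue hc
    · obtain ⟨i, hik, hpi, hi⟩ := hcov k a ha hc
      refine ⟨Y.hubs i, h.hub k i hik ▸ Sym2.mem_map.mpr ⟨_, hi, rfl⟩, ?_⟩
      exact (h.touched_glue_hub_iff hX).mpr ((hp i).mp hpi)
  · rw [h.touched_glue_hub_iff hX, hp]

lemma IsGluing.exists_fullCover_true {X Y : GraphGen} {φ : Fin 3 → X.V → Y.V}
    (h : IsGluing X Y φ) (hX : HubTriangle X) {m : ℕ}
    (hm : ∃ F, FullCover X (fun _ => True) F ∧ F.card ≤ m) :
    ∃ F, FullCover Y (fun _ => True) F ∧ F.card ≤ 3 * m := by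
  obtain ⟨F, hF, hcard⟩ := hm
  refine ⟨glue φ fun _ => F, h.fullCover_glue hX (fun _ => hF.subset)
    (fun _ e he hc => absurd (hF.covers e he) hc) (fun i => ?_), ?_⟩
  · obtain ⟨k, hk⟩ := exists_ne i
    exact iff_of_true trivial ⟨k, hk.symm, (hF.touched_iff i).mpr trivial⟩
  · refine (card_glue_le _ _).trans ?_
    simp only [Finset.sum_const, Finset.card_univ, Fintype.card_fin, smul_eq_mul]
    omega

lemma IsGluing.exists_fullCover_ne {X Y : GraphGen} {φ : Fin 3 → X.V → Y.V}
    (h : IsGluing X Y φ) (hX : HubTriangle X) {j : Fin 3} {m p : ℕ}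
    (hm : ∃ F, FullCover X (· ≠ j) F ∧ F.card ≤ m)
    (hp : ∃ F ⊆ X.edges, CoversOff X j F ∧ F.card ≤ p) :
    ∃ F, FullCover Y (· ≠ j) F ∧ F.card ≤ 2 * m + p := by
  obtain ⟨F, hF, hcard⟩ := hm
  obtain ⟨P, hP, hPc, hPcard⟩ := hp
  refine ⟨glue φ fun k => if k = j then P else F, h.fullCover_glue hX (fun k => ?_)
    (fun k e he hc => ?_) (fun i => ⟨fun hij => ?_, ?_⟩), ?_⟩
  · split_ifs
    exacts [hP, hF.subset]
  · split_ifs at hc with hk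
    · obtain ⟨i, hij, hi⟩ := hPc e he hc
      exact ⟨i, hk ▸ hij, hij, hi⟩
    · exact absurd (hF.covers e he) hc
  · obtain ⟨k, hki, hkj⟩ : ∃ k : Fin 3, k ≠ i ∧ k ≠ j :=
      (by decide : ∀ i j : Fin 3, ∃ k, k ≠ i ∧ k ≠ j) i j
    refine ⟨k, hki.symm, ?_⟩
    rw [if_neg hkj]
    exact (hF.touched_iff i).mpr hij
  · rintro ⟨k, hik, ht⟩ rfl
    rw [if_neg hik.symm] at ht
    exact (hF.touched_iff i).mp ht rfl
  · refine (card_glue_le _ _).trans ?_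
    rw [Fin.sum_univ_three]
    fin_cases j <;> simp <;> omega

/-- If every edge is incident to a hub, a single hub edge per copy covers a gluing. -/
lemma IsGluing.exists_fullCover_three {X Y : GraphGen} {φ : Fin 3 → X.V → Y.V}
    (h : IsGluing X Y φ) (hX : HubTriangle X) (hub : ∀ e ∈ X.edges, ∃ i, X.hubs i ∈ e) :
    ∃ F, FullCover Y (fun _ => True) F ∧ F.card ≤ 3 := by
  refine ⟨glue φ fun k => {s(X.hubs k, X.hubs (k + 1))}, h.fullCover_glue hX (fun k => ?_)
    (fun k e he hc => ?_) (fun i => ?_), (card_glue_le _ _).trans (by simp)⟩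
  · exact Finset.singleton_subset_iff.mpr (hX.adj _ _ (by revert k; decide))
  · obtain ⟨i, hi⟩ := hub e he
    refine ⟨i, ?_, trivial, hi⟩
    rintro rfl
    exact hc ⟨_, hi, _, Finset.mem_singleton_self _, Sym2.mem_mk_left _ _⟩
  · refine iff_of_true trivial ⟨i + 2, by revert i; decide, _, Finset.mem_singleton_self _, ?_⟩
    have : i + 2 + 1 = i := by revert i; decide
    rw [this]
    exact Sym2.mem_mk_right _ _

lemma exists_coversOff_one {X : GraphGen} (hX : HubTriangle X)
    (hub : ∀ e ∈ X.edges, ∃ i, X.hubs i ∈ e) (j : Fin 3) :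
    ∃ F ⊆ X.edges, CoversOff X j F ∧ F.card ≤ 1 := by
  refine ⟨{s(X.hubs j, X.hubs (j + 1))},
    Finset.singleton_subset_iff.mpr (hX.adj _ _ (by revert j; decide)), fun e he hc => ?_, by simp⟩
  obtain ⟨i, hi⟩ := hub e he
  refine ⟨i, ?_, hi⟩
  rintro rfl
  exact hc ⟨_, hi, _, Finset.mem_singleton_self _, Sym2.mem_mk_left _ _⟩

lemma exists_hub_mem_pfwStep_triangle (e : Sym2 (pfwStep triangle).V)
    (he : e ∈ (pfwStep triangle).edges) : ∃ i, (pfwStep triangle).hubs i ∈ e := by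
  rcases mem_pfwStep_edges.mp he with ⟨a, -, rfl⟩ | ⟨a, v, -, rfl⟩
  · induction a with
    | _ p q => exact ⟨p, Sym2.mem_mk_left _ _⟩
  · exact ⟨v, Sym2.mem_mk_left _ _⟩

lemma exists_fullCover_triangle (j : Fin 3) :
    ∃ F, FullCover triangle (· ≠ j) F ∧ F.card ≤ 1 := by
  refine ⟨{s(j + 1, j + 2)}, ⟨Finset.singleton_subset_iff.mpr (triangle_edge_mem j),
    fun e he => ?_, fun i => ?_⟩, (Finset.card_singleton _).le⟩
  · induction e with
    | _ p q =>
      obtain ⟨v, hv, hvj⟩ := (by decide : ∀ j p q : Fin 3, p ≠ q →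
        ∃ v ∈ s(p, q), v ∈ s(j + 1, j + 2)) j p q ((mem_triangle_edges p q).mp he)
      exact ⟨v, hv, _, Finset.mem_singleton_self _, hvj⟩
  · have key : i ∈ s(j + 1, j + 2) ↔ i ≠ j := by
      revert i j
      decide
    rw [← key]
    constructor
    · rintro ⟨f, hf, hi⟩
      obtain rfl := Finset.mem_singleton.mp hf
      exact hi
    · exact fun hi => ⟨_, Finset.mem_singleton_self _, hi⟩

lemma exists_coversOff_triangle (j : Fin 3) :
    ∃ F ⊆ triangle.edges, CoversOff triangle j F ∧ F.card ≤ 0 := by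
  refine ⟨∅, Finset.empty_subset _, fun e he _ => ?_, le_rfl⟩
  induction e with
  | _ p q =>
    exact (by decide : ∀ j p q : Fin 3, p ≠ q → ∃ i, i ≠ j ∧ i ∈ s(p, q)) j p q
      ((mem_triangle_edges p q).mp he)

lemma hubTriangle_pfw (n : ℕ) : HubTriangle (pfw (n + 1)) := by
  induction n with
  | zero => exact hubTriangle_triangle
  | succ n ih => exact ih.pfwStep

lemma exists_isGluing_pfw (n : ℕ) : ∃ φ, IsGluing (pfw (n + 1)) (pfw (n + 2)) φ := by
  induction n with
  | zero => exact ⟨_, isGluing_triangle⟩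
  | succ n ih =>
    obtain ⟨φ, hφ⟩ := ih
    exact ⟨_, hφ.pfwStep (hubTriangle_pfw n)⟩

lemma pow_le_card_of_coversOff (n : ℕ) {F : Finset (Sym2 (pfw (n + 2)).V)}
    (hF : F ⊆ (pfw (n + 2)).edges) {j : Fin 3} (hc : CoversOff (pfw (n + 2)) j F) :
    3 ^ n ≤ F.card := by
  induction n generalizing j with
  | zero =>
    obtain ⟨φ, hφ⟩ := exists_isGluing_pfw 0
    by_cases hj : Touched F ((pfw 2).hubs j)
    · obtain ⟨f, hf, -⟩ := hj
      exact Finset.card_pos.mpr ⟨f, hf⟩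
    · obtain ⟨k, hk⟩ := exists_ne j
      have h1 := hφ.pullback_card_pos (hubTriangle_pfw 0) hF hc hj hk.symm
      have h2 := hφ.sum_card_pullback_le (hubTriangle_pfw 0) F
      have h3 := Finset.single_le_sum (f := fun k => (pullback (φ k) F).card)
        (fun _ _ => Nat.zero_le _) (Finset.mem_univ k)
      simp only [pow_zero] at *
      omega
  | succ n ih =>
    obtain ⟨φ, hφ⟩ := exists_isGluing_pfw (n + 1)
    have h2 := hφ.sum_card_pullback_le (hubTriangle_pfw (n + 1)) F
    have h3 := fun k => ih (Finset.filter_subset _ _)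
      (hφ.coversOff_pullback (hubTriangle_pfw (n + 1)) hF hc.coversOffHubs k)
    have h4 : ∑ _k : Fin 3, 3 ^ n ≤ ∑ k, (pullback (φ k) F).card :=
      Finset.sum_le_sum fun k _ => h3 k
    simp only [Finset.sum_const, Finset.card_univ, Fintype.card_fin, smul_eq_mul] at h4
    rw [pow_succ]
    omega

lemma pow_le_card_of_coversOffHubs (n : ℕ) {F : Finset (Sym2 (pfw (n + 3)).V)}
    (hF : F ⊆ (pfw (n + 3)).edges) (hc : CoversOffHubs (pfw (n + 3)) F) :
    3 ^ (n + 1) ≤ F.card := by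
  obtain ⟨φ, hφ⟩ := exists_isGluing_pfw (n + 1)
  have h2 := hφ.sum_card_pullback_le (hubTriangle_pfw (n + 1)) F
  have h4 : ∑ _k : Fin 3, 3 ^ n ≤ ∑ k, (pullback (φ k) F).card :=
    Finset.sum_le_sum fun k _ => pow_le_card_of_coversOff n (Finset.filter_subset _ _)
      (hφ.coversOff_pullback (hubTriangle_pfw (n + 1)) hF hc k)
  simp only [Finset.sum_const, Finset.card_univ, Fintype.card_fin, smul_eq_mul] at h4
  rw [pow_succ]
  omega

lemma two_mul_add_le_sum {f : Fin 3 → ℕ} {m p : ℕ} (j : Fin 3) (hm : ∀ k, j ≠ k → m ≤ f k)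
    (hp : p ≤ f j) : 2 * m + p ≤ ∑ k, f k := by
  rw [Fin.sum_univ_three]
  have h0 := hm 0
  have h1 := hm 1
  have h2 := hm 2
  fin_cases j <;> simp at * <;> omega

lemma pow_add_pow_le_card (n : ℕ) {F : Finset (Sym2 (pfw (n + 2)).V)}
    (hF : F ⊆ (pfw (n + 2)).edges) {j : Fin 3} (hc : CoversOff (pfw (n + 2)) j F)
    (hj : ¬ Touched F ((pfw (n + 2)).hubs j)) : 3 ^ n + 2 ^ n ≤ F.card := by
  induction n with
  | zero =>
    obtain ⟨φ, hφ⟩ := exists_isGluing_pfw 0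
    exact (two_mul_add_le_sum j (fun k hk => hφ.pullback_card_pos (hubTriangle_pfw 0) hF hc hj hk)
      (Nat.zero_le _)).trans (hφ.sum_card_pullback_le (hubTriangle_pfw 0) F)
  | succ n ih =>
    obtain ⟨φ, hφ⟩ := exists_isGluing_pfw (n + 1)
    have hX := hubTriangle_pfw (n + 1)
    have h1 := two_mul_add_le_sum (f := fun k => (pullback (φ k) F).card) j
      (fun k hk =>
        have h := hφ.coversOff_pullback_of_untouched hX hF hc hj hk
        ih (Finset.filter_subset _ _) h.1 h.2)
      (pow_le_card_of_coversOff n (Finset.filter_subset _ _)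
        (hφ.coversOff_pullback hX hF hc.coversOffHubs j))
    have h2 := hφ.sum_card_pullback_le hX F
    rw [pow_succ, pow_succ]
    omega

lemma exists_fullCover_true_pfw (n : ℕ) :
    ∃ F, FullCover (pfw (n + 3)) (fun _ => True) F ∧ F.card ≤ 3 ^ (n + 1) := by
  induction n with
  | zero =>
    obtain ⟨φ, hφ⟩ := exists_isGluing_pfw 1
    exact hφ.exists_fullCover_three (hubTriangle_pfw 1) exists_hub_mem_pfwStep_triangle
  | succ n ih =>
    obtain ⟨φ, hφ⟩ := exists_isGluing_pfw (n + 2)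
    rw [pow_succ, mul_comm]
    exact hφ.exists_fullCover_true (hubTriangle_pfw (n + 2)) ih

lemma exists_coversOff_pfw (n : ℕ) (j : Fin 3) :
    ∃ F ⊆ (pfw (n + 2)).edges, CoversOff (pfw (n + 2)) j F ∧ F.card ≤ 3 ^ n := by
  cases n with
  | zero => exact exists_coversOff_one (hubTriangle_pfw 1) exists_hub_mem_pfwStep_triangle j
  | succ n =>
    obtain ⟨F, hF, hcard⟩ := exists_fullCover_true_pfw n
    exact ⟨F, hF.subset, fun e he hc => absurd (hF.covers e he) hc, hcard⟩

lemma exists_fullCover_ne_pfw (n : ℕ) (j : Fin 3) :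
    ∃ F, FullCover (pfw (n + 2)) (· ≠ j) F ∧ F.card ≤ 3 ^ n + 2 ^ n := by
  induction n with
  | zero =>
    obtain ⟨φ, hφ⟩ := exists_isGluing_pfw 0
    exact hφ.exists_fullCover_ne (hubTriangle_pfw 0) (exists_fullCover_triangle j)
      (exists_coversOff_triangle j)
  | succ n ih =>
    obtain ⟨φ, hφ⟩ := exists_isGluing_pfw (n + 1)
    obtain ⟨F, hF, hcard⟩ :=
      hφ.exists_fullCover_ne (hubTriangle_pfw (n + 1)) ih (exists_coversOff_pfw n j)
    refine ⟨F, hF, hcard.trans (le_of_eq ?_)⟩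
    ring

lemma FullCover.not_crossHub {X : GraphGen} {p : Fin 3 → Prop} {F : Finset (Sym2 X.V)}
    (hF : FullCover X p F) (i : Fin 3) : ¬ CrossHub X F i := fun ⟨_, e, he, _, hd⟩ =>
  hd (dominated_iff_covered.mpr (hF.covers e he))

lemma FullCover.admissible {X : GraphGen} {p : Fin 3 → Prop} {F : Finset (Sym2 X.V)}
    (hF : FullCover X p F) : Admissible X F :=
  ⟨hF.subset, fun e he hd => absurd (dominated_iff_covered.mpr (hF.covers e he)) hd⟩

lemma FullCover.numCross_eq {X : GraphGen} {p : Fin 3 → Prop} {F : Finset (Sym2 X.V)}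
    (hF : FullCover X p F) : numCross X F = 0 :=
  Finset.card_eq_zero.mpr (Finset.filter_eq_empty_iff.mpr fun i _ => hF.not_crossHub i)

lemma FullCover.numFilled_eq {X : GraphGen} {p : Fin 3 → Prop} {F : Finset (Sym2 X.V)}
    (hF : FullCover X p F) : numFilled X F = (Finset.univ.filter p).card :=
  congrArg Finset.card (Finset.filter_congr fun i _ => hF.touched_iff i)

lemma minAdm_le {X : GraphGen} {a b m : ℕ}
    (h : ∃ F, Admissible X F ∧ numFilled X F = a ∧ numCross X F = b ∧ F.card ≤ m) :
    minAdm X a b ≤ m := by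
  obtain ⟨F, h1, h2, h3, h4⟩ := h
  have h5 : minAdm X a b ≤ F.card := Nat.sInf_le ⟨F, h1, h2, h3, rfl⟩
  exact h5.trans h4

lemma le_minAdm {X : GraphGen} {a b m : ℕ}
    (hne : ∃ F, Admissible X F ∧ numFilled X F = a ∧ numCross X F = b)
    (h : ∀ F, Admissible X F → numFilled X F = a → numCross X F = b → m ≤ F.card) :
    m ≤ minAdm X a b := by
  obtain ⟨F, h1, h2, h3⟩ := hne
  refine le_csInf (s := {k | ∃ F, Admissible X F ∧ numFilled X F = a ∧ numCross X F = b ∧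
    F.card = k}) ⟨_, F, h1, h2, h3, rfl⟩ ?_
  rintro _ ⟨G, g1, g2, g3, rfl⟩
  exact h G g1 g2 g3

lemma Admissible.coversOffHubs {X : GraphGen} {F : Finset (Sym2 X.V)} (hF : Admissible X F) :
    CoversOffHubs X F := fun e he hc =>
  let ⟨i, _, hi⟩ := hF.2 e he (mt dominated_iff_covered.mp hc)
  ⟨i, hi⟩

lemma Admissible.covered {X : GraphGen} {F : Finset (Sym2 X.V)} (hF : Admissible X F)
    (h0 : numCross X F = 0) {e : Sym2 X.V} (he : e ∈ X.edges) : Covered F e := by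
  by_contra hc
  obtain ⟨i, hi, -⟩ := hF.2 e he (mt dominated_iff_covered.mp hc)
  exact Finset.filter_eq_empty_iff.mp (Finset.card_eq_zero.mp h0) (Finset.mem_univ i) hi

lemma card_filter_ne (j : Fin 3) : (Finset.univ.filter (· ≠ j)).card = 2 := by
  rw [Finset.filter_ne', Finset.card_erase_of_mem (Finset.mem_univ j)]
  rfl

lemma cq_zero_pfw (n : ℕ) : cq (pfw (n + 2)) 0 = 3 ^ n + 2 ^ n := by
  obtain ⟨F, hF, hcard⟩ := exists_fullCover_ne_pfw n 0
  have hfill : numFilled _ F = 2 := hF.numFilled_eq.trans (by convert card_filter_ne 0)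
  refine le_antisymm (minAdm_le ⟨F, hF.admissible, hfill, hF.numCross_eq, hcard⟩)
    (le_minAdm ⟨F, hF.admissible, hfill, hF.numCross_eq⟩ fun G hG h2 h0 => ?_)
  obtain ⟨j, hj⟩ : ∃ j, ¬ FilledHub _ G j := by
    by_contra! hall
    rw [numFilled, Finset.filter_true_of_mem fun i _ => hall i] at h2
    simp at h2
  exact pow_add_pow_le_card n hG.1 (fun e he hc => absurd (hG.covered h0 he) hc) hj

lemma dq_zero_pfw (n : ℕ) : dq (pfw (n + 3)) 0 = 3 ^ (n + 1) := by
  obtain ⟨F, hF, hcard⟩ := exists_fullCover_true_pfw n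
  have hfill : numFilled _ F = 3 := hF.numFilled_eq.trans (by simp)
  exact le_antisymm (minAdm_le ⟨F, hF.admissible, hfill, hF.numCross_eq, hcard⟩)
    (le_minAdm ⟨F, hF.admissible, hfill, hF.numCross_eq⟩ fun G hG _ _ =>
      pow_le_card_of_coversOffHubs n hG.1 hG.coversOffHubs)

/-- The edges of `X` having neither `u` nor `v` as an endpoint. -/
noncomputable def edgesAvoiding (X : GraphGen) (u v : X.V) : Finset (Sym2 X.V) :=
  X.edges.filter fun e => u ∉ e ∧ v ∉ e

lemma mem_edgesAvoiding {X : GraphGen} {u v : X.V} {e : Sym2 X.V} :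
    e ∈ edgesAvoiding X u v ↔ e ∈ X.edges ∧ u ∉ e ∧ v ∉ e :=
  Finset.mem_filter

lemma not_touched_edgesAvoiding_left (X : GraphGen) (u v : X.V) :
    ¬ Touched (edgesAvoiding X u v) u := fun ⟨_, hf, hu⟩ => (mem_edgesAvoiding.mp hf).2.1 hu

lemma not_touched_edgesAvoiding_right (X : GraphGen) (u v : X.V) :
    ¬ Touched (edgesAvoiding X u v) v := fun ⟨_, hf, hv⟩ => (mem_edgesAvoiding.mp hf).2.2 hv

lemma not_covered_edgesAvoiding (X : GraphGen) (u v : X.V) :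
    ¬ Covered (edgesAvoiding X u v) s(u, v) := by
  rintro ⟨w, hw, ht⟩
  rcases Sym2.mem_iff.mp hw with rfl | rfl
  · exact not_touched_edgesAvoiding_left _ _ _ ht
  · exact not_touched_edgesAvoiding_right _ _ _ ht

lemma mem_or_mem_of_not_covered_edgesAvoiding {X : GraphGen} {u v : X.V} {e : Sym2 X.V}
    (he : e ∈ X.edges) (hc : ¬ Covered (edgesAvoiding X u v) e) : u ∈ e ∨ v ∈ e := by
  by_contra! h
  exact hc (covered_of_mem (mem_edgesAvoiding.mpr ⟨he, h⟩))

lemma numFilled_eq_card {X : GraphGen} {F : Finset (Sym2 X.V)} {s : Finset (Fin 3)}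
    (h : ∀ i, FilledHub X F i ↔ i ∈ s) : numFilled X F = s.card := by
  refine congrArg Finset.card (Finset.ext fun i => ?_)
  rw [Finset.mem_filter, h]
  exact and_iff_right (Finset.mem_univ i)

lemma numCross_eq_card {X : GraphGen} {F : Finset (Sym2 X.V)} {s : Finset (Fin 3)}
    (h : ∀ i, CrossHub X F i ↔ i ∈ s) : numCross X F = s.card := by
  refine congrArg Finset.card (Finset.ext fun i => ?_)
  rw [Finset.mem_filter, h]
  exact and_iff_right (Finset.mem_univ i)

/-- After a step there are admissible sets with one filled and two cross hubs. -/
lemma exists_admissible_one_two {X : GraphGen} (hX : HubTriangle X) :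
    ∃ F, Admissible (pfwStep X) F ∧ numFilled (pfwStep X) F = 1 ∧
      numCross (pfwStep X) F = 2 := by
  have hY := hX.pfwStep
  set u := (pfwStep X).hubs 1
  set v := (pfwStep X).hubs 2
  have hn := not_covered_edgesAvoiding (pfwStep X) u v
  have huv : s(u, v) ∈ (pfwStep X).edges := hY.adj 1 2 (by decide)
  have n1 : ¬ FilledHub (pfwStep X) (edgesAvoiding (pfwStep X) u v) 1 :=
    not_touched_edgesAvoiding_left _ _ _
  have n2 : ¬ FilledHub (pfwStep X) (edgesAvoiding (pfwStep X) u v) 2 :=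
    not_touched_edgesAvoiding_right _ _ _
  have c1 : CrossHub (pfwStep X) (edgesAvoiding (pfwStep X) u v) 1 :=
    ⟨n1, _, huv, Sym2.mem_mk_left _ _, mt dominated_iff_covered.mp hn⟩
  have c2 : CrossHub (pfwStep X) (edgesAvoiding (pfwStep X) u v) 2 :=
    ⟨n2, _, huv, Sym2.mem_mk_right _ _, mt dominated_iff_covered.mp hn⟩
  have f0 : FilledHub (pfwStep X) (edgesAvoiding (pfwStep X) u v) 0 := by
    have hne : ∀ i : Fin 3, i ≠ 0 → (pfwStep X).hubs i ∉
        s((pfwStep X).hubs 0, newV ⟨_, hX.adj 0 1 (by decide)⟩) := by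
      intro i hi hmem
      rcases Sym2.mem_iff.mp hmem with h | h
      · exact hi (hY.hubs_injective h)
      · exact oldV_ne_newV _ _ h
    exact ⟨_, mem_edgesAvoiding.mpr ⟨mem_pfwStep_edges.mpr
      (Or.inr ⟨⟨_, hX.adj 0 1 (by decide)⟩, X.hubs 0, Sym2.mem_mk_left _ _, rfl⟩),
      hne 1 (by decide), hne 2 (by decide)⟩, Sym2.mem_mk_left _ _⟩
  refine ⟨edgesAvoiding (pfwStep X) u v, ⟨Finset.filter_subset _ _, fun e he hd => ?_⟩,
    numFilled_eq_card (s := {0}) fun i => ?_, numCross_eq_card (s := {1, 2}) fun i => ?_⟩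
  · rcases mem_or_mem_of_not_covered_edgesAvoiding he (mt dominated_iff_covered.mpr hd) with h | h
    exacts [⟨1, c1, h⟩, ⟨2, c2, h⟩]
  · fin_cases i
    exacts [iff_of_true f0 (by decide), iff_of_false n1 (by decide), iff_of_false n2 (by decide)]
  · fin_cases i
    exacts [iff_of_false (fun h => h.1 f0) (by decide), iff_of_true c1 (by decide),
      iff_of_true c2 (by decide)]

/-- After a step there are admissible sets with two filled and one cross hub. -/
lemma exists_admissible_two_one {X : GraphGen} (hX : HubTriangle X) :
    ∃ F, Admissible (pfwStep X) F ∧ numFilled (pfwStep X) F = 2 ∧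
      numCross (pfwStep X) F = 1 := by
  have hY := hX.pfwStep
  have h01 := hX.adj 0 1 (by decide)
  set u := (pfwStep X).hubs 0
  set v : (pfwStep X).V := newV ⟨_, h01⟩
  have huv : s(u, v) ∈ (pfwStep X).edges :=
    mem_pfwStep_edges.mpr (Or.inr ⟨⟨_, h01⟩, X.hubs 0, Sym2.mem_mk_left _ _, rfl⟩)
  have h12 : s((pfwStep X).hubs 1, (pfwStep X).hubs 2) ∈ edgesAvoiding (pfwStep X) u v := by
    refine mem_edgesAvoiding.mpr ⟨hY.adj 1 2 (by decide), fun h => ?_, fun h => ?_⟩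
    · rcases Sym2.mem_iff.mp h with h | h
      · exact absurd (hY.hubs_injective h) (by decide)
      · exact absurd (hY.hubs_injective h) (by decide)
    · rcases Sym2.mem_iff.mp h with h | h
      · exact oldV_ne_newV _ _ h.symm
      · exact oldV_ne_newV _ _ h.symm
  have n0 : ¬ FilledHub (pfwStep X) (edgesAvoiding (pfwStep X) u v) 0 :=
    not_touched_edgesAvoiding_left _ _ _
  have f1 : FilledHub (pfwStep X) (edgesAvoiding (pfwStep X) u v) 1 :=
    ⟨_, h12, Sym2.mem_mk_left _ _⟩
  have f2 : FilledHub (pfwStep X) (edgesAvoiding (pfwStep X) u v) 2 :=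
    ⟨_, h12, Sym2.mem_mk_right _ _⟩
  have c0 : CrossHub (pfwStep X) (edgesAvoiding (pfwStep X) u v) 0 :=
    ⟨n0, _, huv, Sym2.mem_mk_left _ _,
      mt dominated_iff_covered.mp (not_covered_edgesAvoiding _ _ _)⟩
  refine ⟨edgesAvoiding (pfwStep X) u v, ⟨Finset.filter_subset _ _, fun e he hd => ?_⟩,
    numFilled_eq_card (s := {1, 2}) fun i => ?_, numCross_eq_card (s := {0}) fun i => ?_⟩
  · have hc := mt dominated_iff_covered.mpr hd
    rcases mem_or_mem_of_not_covered_edgesAvoiding he hc with h | h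
    · exact ⟨0, c0, h⟩
    · rcases mem_pfwStep_edges.mp he with ⟨a, -, rfl⟩ | ⟨a, w, hw, rfl⟩
      · obtain ⟨w, -, hw⟩ := Sym2.mem_map.mp h
        exact absurd hw (oldV_ne_newV _ _)
      · rcases Sym2.mem_iff.mp h with h | h
        · exact absurd h.symm (oldV_ne_newV _ _)
        · obtain rfl := newV_injective h
          rcases Sym2.mem_iff.mp hw with rfl | rfl
          · exact ⟨0, c0, Sym2.mem_mk_left _ _⟩
          · exact absurd ⟨_, Sym2.mem_mk_left _ _, f1⟩ hc
  · fin_cases i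
    exacts [iff_of_false n0 (by decide), iff_of_true f1 (by decide), iff_of_true f2 (by decide)]
  · fin_cases i
    exacts [iff_of_true c0 (by decide), iff_of_false (fun h => h.1 f1) (by decide),
      iff_of_false (fun h => h.1 f2) (by decide)]

lemma pow_le_bq_two_pfw (n : ℕ) : 3 ^ (n + 1) ≤ bq (pfw (n + 3)) 2 :=
  le_minAdm (exists_admissible_one_two (hubTriangle_pfw (n + 1))) fun _ hG _ _ =>
    pow_le_card_of_coversOffHubs n hG.1 hG.coversOffHubs

lemma pow_le_cq_one_pfw (n : ℕ) : 3 ^ (n + 1) ≤ cq (pfw (n + 3)) 1 :=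
  le_minAdm (exists_admissible_two_one (hubTriangle_pfw (n + 1))) fun _ hG _ _ =>
    pow_le_card_of_coversOffHubs n hG.1 hG.coversOffHubs

/-- the recursion for `c_{n+1}^0` in the pseudofractal scale-free web. -/
theorem pfw_c0_recursion (n : ℕ) (hn : 3 ≤ n) :
    cq (pfw (n + 1)) 0 =
      min (3 * cq (pfw n) 0)
      (min (2 * cq (pfw n) 0 + dq (pfw n) 0)
      (min (2 * cq (pfw n) 0 + bq (pfw n) 2)
      (2 * cq (pfw n) 0 + cq (pfw n) 1))) := by
  obtain ⟨m, rfl⟩ : ∃ m, n = m + 3 := ⟨n - 3, by omega⟩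
  have h1 : cq (pfw (m + 3 + 1)) 0 = 3 ^ (m + 2) + 2 ^ (m + 2) := cq_zero_pfw (m + 2)
  have h2 : cq (pfw (m + 3)) 0 = 3 ^ (m + 1) + 2 ^ (m + 1) := cq_zero_pfw (m + 1)
  have h3 := dq_zero_pfw m
  have h4 := pow_le_bq_two_pfw m
  have h5 := pow_le_cq_one_pfw m
  rw [h1, h2, h3]
  have h6 : 3 ^ (m + 2) = 3 * 3 ^ (m + 1) := by ring
  have h7 : 2 ^ (m + 2) = 2 * 2 ^ (m + 1) := by ring
  omega
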